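/- Let Q(x) = √2/cosh(x), L⁻ u = −u'' + u − Q² u and L⁺ u = −u'' + u − 3Q² u. For ε > 0, call σ ∈ ℂ an unstable eigenvalue if Re σ > 0 and there exists a nonzero pair (u, v) of complex-valued Schwartz functions on ℝ satisfying L⁺ u + ε² u = −σ v and L⁻ v + ε² v = σ u. Then for every ε > 0 there is at most one unstable eigenvalue, and there exists ε₀ > 0 such that for every 0 < ε ≤ ε₀ there is exactly one unstable eigenvalue. -/

import Mathlib

/-- The NLS ground state `Q(x) = √2 / cosh x`. -/
noncomputable def Q (x : ℝ) : ℝ := Real.sqrt 2 / Real.cosh x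

/-- `σ` is an unstable eigenvalue for the transverse-frequency-`ε` linearization of the
cubic NLS about `Q`: `Re σ > 0` and there is a nonzero Schwartz pair `(u, v)` with
`L⁺u + ε²u = −σv` and `L⁻v + ε²v = σu`, where `L⁻u = −u'' + u − Q²u`,
`L⁺u = −u'' + u − 3Q²u`. -/
def IsUnstableEigenvalue (ε : ℝ) (σ : ℂ) : Prop :=
  0 < σ.re ∧ ∃ u v : SchwartzMap ℝ ℂ, (u ≠ 0 ∨ v ≠ 0) ∧
    (∀ x : ℝ, (-iteratedDeriv 2 (⇑u) x + u x - 3 * (Q x : ℂ) ^ 2 * u x)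
        + (ε : ℂ) ^ 2 * u x = -σ * v x) ∧
    (∀ x : ℝ, (-iteratedDeriv 2 (⇑v) x + v x - (Q x : ℂ) ^ 2 * v x)
        + (ε : ℂ) ^ 2 * v x = σ * u x)

section Helpers

open Real Set Filter Topology MeasureTheory

/-- hyperbolic secant -/
noncomputable def sc (x : ℝ) : ℝ := (Real.cosh x)⁻¹
/-- hyperbolic tangent -/
noncomputable def th (x : ℝ) : ℝ := Real.sinh x * (Real.cosh x)⁻¹

lemma sc_pos (x : ℝ) : 0 < sc x := inv_pos.2 (Real.cosh_pos x)
lemma sc_le_one (x : ℝ) : sc x ≤ 1 := inv_le_one_of_one_le₀ (Real.one_le_cosh x)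
lemma sc_sq (x : ℝ) : sc x ^ 2 = 1 - th x ^ 2 := by
  have h := (Real.cosh_pos x).ne'
  have := Real.cosh_sq x
  unfold sc th
  field_simp
  linarith
lemma abs_th_le (x : ℝ) : |th x| ≤ 1 := by
  rw [← sq_le_one_iff_abs_le_one]
  nlinarith [sc_sq x, sc_pos x, sq_nonneg (sc x)]
lemma cosh_mul_sc (x : ℝ) : Real.cosh x * sc x = 1 := mul_inv_cancel₀ (Real.cosh_pos x).ne'
lemma sinh_eq_th (x : ℝ) : Real.sinh x = th x * Real.cosh x := by
  have h := (Real.cosh_pos x).ne'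
  unfold th; field_simp
lemma hasDerivAt_sc (x : ℝ) : HasDerivAt sc (-(sc x * th x)) x := by
  have h := (Real.hasDerivAt_cosh x).fun_inv (Real.cosh_pos x).ne'
  refine h.congr_deriv ?_
  have := (Real.cosh_pos x).ne'
  unfold sc th
  field_simp
lemma hasDerivAt_th (x : ℝ) : HasDerivAt th (sc x ^ 2) x := by
  have h := (Real.hasDerivAt_sinh x).mul (hasDerivAt_sc x)
  refine h.congr_deriv ?_
  have := (Real.cosh_pos x).ne'
  have := Real.cosh_sq x
  unfold sc th
  field_simp
  linarith
lemma continuous_sc : Continuous sc :=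
  continuous_iff_continuousAt.2 fun x => (hasDerivAt_sc x).continuousAt
lemma continuous_th : Continuous th :=
  continuous_iff_continuousAt.2 fun x => (hasDerivAt_th x).continuousAt
lemma sc_abs (x : ℝ) : sc |x| = sc x := by unfold sc; rw [Real.cosh_abs]
lemma th_zero : th 0 = 0 := by simp [th]
lemma sc_zero : sc 0 = 1 := by simp [sc]
lemma th_abs_sq (x : ℝ) : th |x| ^ 2 = th x ^ 2 := by
  have := sc_sq x; have := sc_sq |x|; rw [sc_abs] at this; linarith
lemma sc_le_exp (x : ℝ) : sc x ≤ 2 * Real.exp (-x) := by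
  have h := Real.cosh_eq x
  have h1 := Real.exp_pos x
  have h2 := Real.exp_pos (-x)
  have h3 : Real.exp x * Real.exp (-x) = 1 := by rw [← Real.exp_add]; simp
  unfold sc
  rw [inv_le_iff_one_le_mul₀ (Real.cosh_pos x), h]
  nlinarith
lemma cosh_le_exp {x : ℝ} (hx : 0 ≤ x) : Real.cosh x ≤ Real.exp x := by
  have h := Real.cosh_eq x
  have : Real.exp (-x) ≤ Real.exp x := Real.exp_le_exp.2 (by linarith)
  linarith

/-! ### Weighted space -/

/-- the weight -/
noncomputable def wt (x : ℝ) : ℝ := Real.exp (-(|x| / 2))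
lemma wt_pos (x : ℝ) : 0 < wt x := Real.exp_pos _
lemma continuous_wt : Continuous wt := by unfold wt; fun_prop
lemma wt_abs (x : ℝ) : wt |x| = wt x := by simp [wt]
lemma wt_of_nonneg {x : ℝ} (hx : 0 ≤ x) : wt x = Real.exp (-(1/2) * x) := by
  unfold wt; rw [abs_of_nonneg hx]; congr 1; ring

abbrev XX := BoundedContinuousFunction ℝ ℝ

/-- the function represented by an element of the space -/
noncomputable def io (g : XX) (x : ℝ) : ℝ := wt x * g x

lemma continuous_io (g : XX) : Continuous (io g) := continuous_wt.mul g.continuous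
lemma abs_io_le (g : XX) (x : ℝ) : |io g x| ≤ ‖g‖ * wt x := by
  unfold io
  rw [abs_mul, abs_of_pos (wt_pos x), mul_comm]
  exact mul_le_mul_of_nonneg_right (g.norm_coe_le_norm x) (wt_pos x).le
lemma io_add (f g : XX) (x : ℝ) : io (f + g) x = io f x + io g x := by
  simp [io, mul_add]
lemma io_sub (f g : XX) (x : ℝ) : io (f - g) x = io f x - io g x := by
  simp [io, mul_sub]
lemma io_neg (f : XX) (x : ℝ) : io (-f) x = - io f x := by
  simp [io]
lemma io_smul (c : ℝ) (f : XX) (x : ℝ) : io (c • f) x = c * io f x := by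
  simp [io]; ring

/-- build an element of the space -/
noncomputable def mkX (f : ℝ → ℝ) (hf : Continuous f) (C : ℝ) (hC : ∀ x, |f x| ≤ C * wt x) : XX :=
  BoundedContinuousFunction.ofNormedAddCommGroup (fun x => f x * Real.exp (|x| / 2))
    (by fun_prop) C (by
      intro x
      rw [norm_mul, Real.norm_eq_abs, Real.norm_of_nonneg (Real.exp_pos _).le]
      have := mul_le_mul_of_nonneg_right (hC x) (Real.exp_pos (|x| / 2)).le
      rwa [mul_assoc, wt, ← Real.exp_add, neg_add_cancel, Real.exp_zero, mul_one] at this)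
lemma io_mkX (f : ℝ → ℝ) (hf : Continuous f) (C : ℝ) (hC : ∀ x, |f x| ≤ C * wt x) (x : ℝ) :
    io (mkX f hf C hC) x = f x := by
  unfold io mkX wt
  simp only [BoundedContinuousFunction.coe_ofNormedAddCommGroup]
  rw [mul_comm, mul_assoc, ← Real.exp_add]; simp
lemma norm_mkX_le (f : ℝ → ℝ) (hf : Continuous f) (C : ℝ) (hC : ∀ x, |f x| ≤ C * wt x)
    (h0 : 0 ≤ C) : ‖mkX f hf C hC‖ ≤ C :=
  BoundedContinuousFunction.norm_ofNormedAddCommGroup_le _ h0 _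
lemma io_injective {f g : XX} (h : ∀ x, io f x = io g x) : f = g := by
  ext x
  exact mul_left_cancel₀ (wt_pos x).ne' (h x)

/-- operators from pointwise formulas -/
lemma exists_op (F : XX → ℝ → ℝ) (C : ℝ) (hC : 0 ≤ C) (hc : ∀ g, Continuous (F g))
    (hb : ∀ g x, |F g x| ≤ C * ‖g‖ * wt x)
    (hadd : ∀ f g x, F (f + g) x = F f x + F g x)
    (hsmul : ∀ (c : ℝ) g x, F (c • g) x = c * F g x) :
    ∃ A : XX →L[ℝ] XX, ∀ g x, io (A g) x = F g x := by
  refine ⟨LinearMap.mkContinuous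
    { toFun := fun g => mkX (F g) (hc g) (C * ‖g‖) (hb g)
      map_add' := ?_
      map_smul' := ?_ } C ?_, ?_⟩
  · intro f g
    apply io_injective; intro x
    rw [io_add, io_mkX, io_mkX, io_mkX, hadd]
  · intro c g
    apply io_injective; intro x
    rw [RingHom.id_apply, io_smul, io_mkX, io_mkX, hsmul]
  · intro g
    exact norm_mkX_le _ (hc g) _ (hb g) (by positivity)
  · intro g x
    exact io_mkX (F g) (hc g) _ (hb g) x

/-! ### The integral operators -/

/-- `f` is continuous and bounded by the weight -/
def Wb (M : ℝ) (f : ℝ → ℝ) : Prop := Continuous f ∧ ∀ x, |f x| ≤ M * wt x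

lemma wb_io (g : XX) : Wb ‖g‖ (io g) := ⟨continuous_io g, abs_io_le g⟩

lemma integrableOn_wt {a : ℝ} (ha : 0 ≤ a) : IntegrableOn wt (Ioi a) := by
  have := integrableOn_exp_mul_Ioi (a := -(1/2)) (by norm_num) a
  exact this.congr_fun (fun x hx => (wt_of_nonneg (ha.trans (le_of_lt hx))).symm) measurableSet_Ioi

lemma integral_wt {a : ℝ} (ha : 0 ≤ a) : ∫ x in Ioi a, wt x = 2 * wt a := by
  rw [setIntegral_congr_fun measurableSet_Ioi
    (fun x hx => wt_of_nonneg (ha.trans (le_of_lt hx))), integral_exp_mul_Ioi (by norm_num),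
    wt_of_nonneg ha]
  ring

lemma sc_pow_le_one (k : ℕ) (x : ℝ) : sc x ^ k ≤ 1 := pow_le_one₀ (sc_pos x).le (sc_le_one x)

lemma Wb.integrableOn {M : ℝ} {f : ℝ → ℝ} (hf : Wb M f) (k : ℕ) {a : ℝ} (ha : 0 ≤ a) :
    IntegrableOn (fun z => sc z ^ k * f z) (Ioi a) := by
  refine Integrable.mono' ((integrableOn_wt ha).const_mul M) ?_ ?_
  · exact (((continuous_sc.pow k).mul hf.1).aestronglyMeasurable)
  · refine Eventually.of_forall fun z => ?_
    rw [norm_mul, Real.norm_of_nonneg (pow_pos (sc_pos z) k).le, Real.norm_eq_abs]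
    calc _ ≤ 1 * |f z| := mul_le_mul_of_nonneg_right (sc_pow_le_one k z) (abs_nonneg _)
      _ ≤ _ := by rw [one_mul]; exact hf.2 z

/-- solution of `-w' + k th w = f` decaying at infinity -/
noncomputable def rr (k : ℕ) (f : ℝ → ℝ) (x : ℝ) : ℝ :=
  Real.cosh x ^ k * ((∫ z in Ioi (0:ℝ), sc z ^ k * f z) - ∫ z in (0:ℝ)..x, sc z ^ k * f z)

lemma hasDerivAt_rr {k : ℕ} {f : ℝ → ℝ} (hf : Continuous f) (x : ℝ) :
    HasDerivAt (rr k f) (k * th x * rr k f x - f x) x := by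
  have hc : Continuous fun z => sc z ^ k * f z := (continuous_sc.pow k).mul hf
  have h1 := intervalIntegral.integral_hasDerivAt_right (hc.intervalIntegrable 0 x)
    hc.stronglyMeasurable.stronglyMeasurableAtFilter hc.continuousAt
  have h2 := ((Real.hasDerivAt_cosh x).fun_pow k).mul (h1.const_sub (∫ z in Ioi (0:ℝ), sc z ^ k * f z))
  refine h2.congr_deriv ?_
  unfold rr
  rw [sinh_eq_th]
  have h3 : Real.cosh x ^ k * sc x ^ k = 1 := by rw [← mul_pow, cosh_mul_sc, one_pow]
  have h4 : (k:ℝ) * Real.cosh x ^ (k-1) * Real.cosh x = k * Real.cosh x ^ k := by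
    rcases k with _ | k
    · simp
    · simp [pow_succ]; ring
  linear_combination (th x * ((∫ z in Ioi (0:ℝ), sc z ^ k * f z) - ∫ z in (0:ℝ)..x, sc z ^ k * f z)) * h4 - f x * h3

lemma continuous_rr {k : ℕ} {f : ℝ → ℝ} (hf : Continuous f) : Continuous (rr k f) :=
  continuous_iff_continuousAt.2 fun x => (hasDerivAt_rr hf x).continuousAt

lemma abs_rr_le {k : ℕ} {M : ℝ} {f : ℝ → ℝ} (hf : Wb M f) {x : ℝ} (hx : 0 ≤ x) :
    |rr k f x| ≤ 2 * M * wt x := by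
  have h1 : rr k f x = ∫ z in Ioi x, Real.cosh x ^ k * (sc z ^ k * f z) := by
    unfold rr
    rw [integral_const_mul, ← intervalIntegral.integral_interval_add_Ioi (hf.integrableOn k le_rfl)
      (hf.integrableOn k hx)]
    ring
  rw [h1, ← Real.norm_eq_abs]
  have h2 : 2 * M * wt x = ∫ z in Ioi x, M * wt z := by
    rw [integral_const_mul, integral_wt hx]; ring
  rw [h2]
  refine norm_integral_le_of_norm_le ((integrableOn_wt hx).const_mul M) ?_
  refine (ae_restrict_iff' measurableSet_Ioi).2 (Eventually.of_forall fun z hz => ?_)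
  rw [← mul_assoc, ← mul_pow, norm_mul, Real.norm_eq_abs, Real.norm_eq_abs]
  have hz' : x ≤ z := le_of_lt hz
  have h3 : Real.cosh x * sc z ≤ 1 := by
    unfold sc
    rw [mul_inv_le_iff₀ (Real.cosh_pos z), one_mul, Real.cosh_le_cosh, abs_of_nonneg hx,
      abs_of_nonneg (hx.trans hz')]
    exact hz'
  have h4 : 0 ≤ Real.cosh x * sc z := (mul_pos (Real.cosh_pos x) (sc_pos z)).le
  rw [abs_of_nonneg (pow_nonneg h4 k)]
  calc _ ≤ 1 * |f z| := mul_le_mul_of_nonneg_right (pow_le_one₀ h4 h3) (abs_nonneg _)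
      _ ≤ _ := by rw [one_mul]; exact hf.2 z

lemma rr_add {k : ℕ} {M N : ℝ} {f g : ℝ → ℝ} (hf : Wb M f) (hg : Wb N g) (x : ℝ) :
    rr k (fun z => f z + g z) x = rr k f x + rr k g x := by
  unfold rr
  have hcf : Continuous fun z => sc z ^ k * f z := (continuous_sc.pow k).mul hf.1
  have hcg : Continuous fun z => sc z ^ k * g z := (continuous_sc.pow k).mul hg.1
  simp only [mul_add]
  rw [integral_add (hf.integrableOn k le_rfl) (hg.integrableOn k le_rfl),
    intervalIntegral.integral_add (hcf.intervalIntegrable _ _) (hcg.intervalIntegrable _ _)]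
  ring
lemma rr_smul {k : ℕ} {f : ℝ → ℝ} (c x : ℝ) :
    rr k (fun z => c * f z) x = c * rr k f x := by
  unfold rr
  simp only [mul_left_comm _ c]
  rw [integral_const_mul, intervalIntegral.integral_const_mul]
  ring

/-- solution of `y' + th y = w`, `y(0) = 0` -/
noncomputable def nu (w : ℝ → ℝ) (x : ℝ) : ℝ := sc x * ∫ y in (0:ℝ)..x, Real.cosh y * w y

lemma hasDerivAt_nu {w : ℝ → ℝ} (hw : Continuous w) (x : ℝ) :
    HasDerivAt (nu w) (w x - th x * nu w x) x := by
  have hc : Continuous fun z => Real.cosh z * w z := Real.continuous_cosh.mul hw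
  have h1 := intervalIntegral.integral_hasDerivAt_right (hc.intervalIntegrable 0 x)
    hc.stronglyMeasurable.stronglyMeasurableAtFilter hc.continuousAt
  refine ((hasDerivAt_sc x).mul h1).congr_deriv ?_
  unfold nu
  linear_combination w x * cosh_mul_sc x

lemma continuous_nu {w : ℝ → ℝ} (hw : Continuous w) : Continuous (nu w) :=
  continuous_iff_continuousAt.2 fun x => (hasDerivAt_nu hw x).continuousAt

lemma nu_zero (w : ℝ → ℝ) : nu w 0 = 0 := by simp [nu]

lemma abs_nu_le {M : ℝ} {w : ℝ → ℝ} (hw : Wb M w) {x : ℝ} (hx : 0 ≤ x) :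
    |nu w x| ≤ 4 * M * wt x := by
  have hM : 0 ≤ M := by
    have := (abs_nonneg _).trans (hw.2 0)
    exact nonneg_of_mul_nonneg_left this (wt_pos 0)
  have h1 : |∫ y in (0:ℝ)..x, Real.cosh y * w y| ≤ ∫ y in (0:ℝ)..x, M * Real.exp ((1/2) * y) := by
    rw [← Real.norm_eq_abs]
    refine intervalIntegral.norm_integral_le_of_norm_le hx ?_ ?_
    · refine Eventually.of_forall fun y hy => ?_
      rw [norm_mul, Real.norm_eq_abs, Real.norm_eq_abs, abs_of_pos (Real.cosh_pos y)]
      calc _ ≤ Real.exp y * (M * wt y) :=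
            mul_le_mul (cosh_le_exp hy.1.le) (hw.2 y) (abs_nonneg _) (Real.exp_pos _).le
        _ = _ := by
            rw [wt_of_nonneg hy.1.le, mul_left_comm, ← Real.exp_add]; congr 2; ring
    · exact Continuous.intervalIntegrable (by fun_prop) _ _
  have h2 : ∫ y in (0:ℝ)..x, M * Real.exp ((1/2) * y) = M * (2 * (Real.exp ((1/2) * x) - 1)) := by
    have : ∀ y ∈ uIcc 0 x, HasDerivAt (fun y => M * (2 * Real.exp ((1/2) * y))) (M * Real.exp ((1/2) * y)) y := by
      intro y _
      have h := (((hasDerivAt_id y).const_mul (1/2:ℝ)).exp.const_mul 2).const_mul M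
      refine h.congr_deriv ?_
      simp only [id]; ring
    rw [intervalIntegral.integral_eq_sub_of_hasDerivAt this
      (Continuous.intervalIntegrable (by fun_prop) _ _)]
    simp; ring
  unfold nu
  rw [abs_mul, abs_of_pos (sc_pos x)]
  calc _ ≤ (2 * Real.exp (-x)) * (M * (2 * (Real.exp ((1/2) * x) - 1))) :=
        mul_le_mul (sc_le_exp x) (h1.trans h2.le) (abs_nonneg _) (by positivity)
    _ ≤ (2 * Real.exp (-x)) * (M * (2 * (Real.exp ((1/2) * x)))) := by gcongr; linarith
    _ = 4 * M * (Real.exp (-x) * Real.exp ((1/2) * x)) := by ring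
    _ = _ := by rw [wt_of_nonneg hx, ← Real.exp_add]; congr 2; ring

lemma nu_add {f g : ℝ → ℝ} (hf : Continuous f) (hg : Continuous g) (x : ℝ) :
    nu (fun z => f z + g z) x = nu f x + nu g x := by
  unfold nu
  have hcf : Continuous fun z => Real.cosh z * f z := Real.continuous_cosh.mul hf
  have hcg : Continuous fun z => Real.cosh z * g z := Real.continuous_cosh.mul hg
  simp only [mul_add]
  rw [intervalIntegral.integral_add (hcf.intervalIntegrable _ _) (hcg.intervalIntegrable _ _)]
  ring
lemma nu_smul {f : ℝ → ℝ} (c x : ℝ) :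
    nu (fun z => c * f z) x = c * nu f x := by
  unfold nu
  simp only [mul_left_comm _ c]
  rw [intervalIntegral.integral_const_mul]
  ring

lemma exists_R (k : ℕ) : ∃ A : XX →L[ℝ] XX, ∀ g x, io (A g) x = rr k (io g) |x| := by
  refine exists_op (fun g x => rr k (io g) |x|) 2 (by norm_num) ?_ ?_ ?_ ?_
  · intro g; exact (continuous_rr (continuous_io g)).comp continuous_abs
  · intro g x
    have := abs_rr_le (k := k) (wb_io g) (abs_nonneg x)
    rwa [wt_abs] at this
  · intro f g x
    rw [← rr_add (wb_io f) (wb_io g)]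
    congr 1; ext z; exact io_add f g z
  · intro c g x
    rw [← rr_smul]
    congr 1; ext z; exact io_smul c g z

lemma exists_V : ∃ A : XX →L[ℝ] XX, ∀ g x, io (A g) x = nu (io g) |x| := by
  refine exists_op (fun g x => nu (io g) |x|) 4 (by norm_num) ?_ ?_ ?_ ?_
  · intro g; exact (continuous_nu (continuous_io g)).comp continuous_abs
  · intro g x
    have := abs_nu_le (wb_io g) (abs_nonneg x)
    rwa [wt_abs] at this
  · intro f g x
    rw [← nu_add (continuous_io f) (continuous_io g)]
    congr 1; ext z; exact io_add f g z
  · intro c g x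
    rw [← nu_smul]
    congr 1; ext z; exact io_smul c g z

lemma exists_T : ∃ A : XX →L[ℝ] XX, ∀ g x, io (A g) x = th |x| * io g |x| := by
  refine exists_op (fun g x => th |x| * io g |x|) 1 (by norm_num) ?_ ?_ ?_ ?_
  · intro g
    exact (continuous_th.comp continuous_abs).mul ((continuous_io g).comp continuous_abs)
  · intro g x
    rw [abs_mul]
    calc _ ≤ 1 * |io g (abs x)| := mul_le_mul_of_nonneg_right (abs_th_le _) (abs_nonneg _)
      _ ≤ _ := by
        have := abs_io_le g |x|
        rw [wt_abs] at this; linarith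
  · intro f g x
    rw [io_add]; ring
  · intro c g x
    rw [io_smul]; ring

lemma exp_neg_le_wt (x : ℝ) : Real.exp (-|x|) ≤ wt x := by
  unfold wt; apply Real.exp_le_exp.2; linarith [abs_nonneg x]

lemma sc_le_wt (x : ℝ) : sc x ≤ 2 * wt x := by
  have h := sc_le_exp |x|
  rw [sc_abs] at h
  linarith [exp_neg_le_wt x]

/-- representative of sech -/
lemma exists_e : ∃ g : XX, ∀ x, io g x = sc x :=
  ⟨mkX sc continuous_sc 2 (fun x => by rw [abs_of_pos (sc_pos x)]; exact sc_le_wt x),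
    fun x => io_mkX _ _ _ _ _⟩

/-- the kernel function of `L⁺` -/
noncomputable def ph (x : ℝ) : ℝ := sc x * th x

lemma exists_ph : ∃ g : XX, ∀ x, io g x = ph |x| := by
  refine ⟨mkX (fun x => ph |x|) ?_ 2 ?_, fun x => io_mkX _ _ _ _ _⟩
  · exact (continuous_sc.mul continuous_th).comp continuous_abs
  · intro x
    unfold ph
    rw [abs_mul, abs_of_pos (sc_pos _), sc_abs]
    calc _ ≤ sc x * 1 := mul_le_mul_of_nonneg_left (abs_th_le _) (sc_pos x).le
      _ ≤ _ := by rw [mul_one]; exact sc_le_wt x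

/-- the even solution of `L⁺ S = - sech` -/
noncomputable def S0 (x : ℝ) : ℝ := (sc x - x * (sc x * th x)) / 2

lemma continuous_S0 : Continuous S0 := by
  unfold S0
  have := continuous_sc; have := continuous_th
  fun_prop

lemma abs_mul_sc_le (x : ℝ) : |x| * sc x ≤ 4 * wt x := by
  have h1 := sc_le_exp |x|
  rw [sc_abs] at h1
  have h2 : Real.exp (-|x|) = wt x * wt x := by
    unfold wt; rw [← Real.exp_add]; congr 1; ring
  have h3 : |x| * wt x ≤ 2 := by
    unfold wt
    have := Real.add_one_le_exp (|x| / 2)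
    have h4 : Real.exp (|x|/2) * Real.exp (-(|x|/2)) = 1 := by rw [← Real.exp_add]; simp
    have := mul_le_mul_of_nonneg_right this (Real.exp_pos (-(|x|/2))).le
    nlinarith [Real.exp_pos (-(|x|/2))]
  have := mul_le_mul_of_nonneg_left h1 (abs_nonneg x)
  have h7 := mul_le_mul_of_nonneg_right h3 (wt_pos x).le
  rw [h2] at this
  linarith

lemma abs_S0_le (x : ℝ) : |S0 x| ≤ 3 * wt x := by
  have h5 : |x * (sc x * th x)| ≤ |x| * sc x := by
    rw [abs_mul, abs_mul, abs_of_pos (sc_pos x)]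
    have := mul_le_mul_of_nonneg_left (abs_th_le x) (mul_nonneg (abs_nonneg x) (sc_pos x).le)
    linarith
  have h6 := abs_mul_sc_le x
  have h8 := sc_le_wt x
  unfold S0
  rw [abs_div, abs_two, div_le_iff₀ two_pos]
  calc _ ≤ |sc x| + |x * (sc x * th x)| := abs_sub _ _
    _ ≤ _ := by rw [abs_of_pos (sc_pos x)]; linarith

lemma exists_s : ∃ g : XX, ∀ x, io g x = S0 x :=
  ⟨mkX S0 continuous_S0 3 abs_S0_le, fun x => io_mkX _ _ _ _ _⟩

/-! ### Abstract perturbation lemma -/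
lemma abs_pert {Y : Type*} [NormedAddCommGroup Y] [NormedSpace ℝ Y] [CompleteSpace Y]
    (K0 K1 : Y →L[ℝ] Y) (F0 F1 : Y →L[ℝ] ℝ) (z0 : Y)
    (h3 : F0 z0 + 3 * F1 z0 < 0) (h5 : 0 < F0 z0 + 5 * F1 z0) :
    ∃ d0 : ℝ, 0 < d0 ∧ ∀ d : ℝ, 0 < d → d ≤ d0 → ∃ m : ℝ, 3 ≤ m ∧ ∃ z : Y,
      z = z0 + d • (K0 z + m • K1 z) ∧ F0 z + m * F1 z = 0 := by
  let N : ℝ × ℝ → (Y →L[ℝ] Y) := fun q => 1 - q.1 • (K0 + q.2 • K1)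
  have hN : Continuous N := by fun_prop
  let Z : ℝ × ℝ → Y := fun q => Ring.inverse (N q) z0
  let G : ℝ × ℝ → ℝ := fun q => F0 (Z q) + q.2 * F1 (Z q)
  have hZ : ∀ q, IsUnit (N q) → ContinuousAt Z q := by
    rintro q ⟨u, hu⟩
    have h1 : ContinuousAt Ring.inverse (N q) := hu ▸ NormedRing.inverse_continuousAt u
    have h2 : ContinuousAt (fun q => Ring.inverse (N q)) q := h1.comp hN.continuousAt
    exact h2.clm_apply continuousAt_const
  have hG : ∀ q, IsUnit (N q) → ContinuousAt G q := by
    intro q hq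
    have := hZ q hq
    exact (F0.continuous.continuousAt.comp this).add
      (continuousAt_snd.mul (F1.continuous.continuousAt.comp this))
  have hN0 : ∀ m, N (0, m) = 1 := by intro m; simp [N]
  have hZ0 : ∀ m, Z (0, m) = z0 := by intro m; simp [Z, hN0]
  have hcont0 : ∀ m, ContinuousAt (fun d : ℝ => G (d, m)) 0 := by
    intro m
    have h1 : ContinuousAt G (0, m) := hG _ (by rw [hN0]; exact isUnit_one)
    exact ContinuousAt.comp (f := fun d : ℝ => (d, m)) h1 (by fun_prop)
  have e3 : ∀ᶠ d in 𝓝 (0:ℝ), G (d, 3) < 0 := by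
    refine (hcont0 3).eventually_lt continuousAt_const ?_
    simpa [G, hZ0] using h3
  have e5 : ∀ᶠ d in 𝓝 (0:ℝ), 0 < G (d, 5) := by
    refine continuousAt_const.eventually_lt (hcont0 5) ?_
    simpa [G, hZ0] using h5
  have eU : ∀ᶠ d in 𝓝 (0:ℝ), |d| * (‖K0‖ + 5 * ‖K1‖) < 1 := by
    have : ContinuousAt (fun d : ℝ => |d| * (‖K0‖ + 5 * ‖K1‖)) 0 := by fun_prop
    refine this.eventually_lt continuousAt_const ?_
    simp
  obtain ⟨r, hr, hball⟩ := Metric.eventually_nhds_iff.1 (e3.and (e5.and eU))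
  refine ⟨r / 2, by positivity, fun d hd hd' => ?_⟩
  obtain ⟨g3, g5, gU⟩ := hball (y := d) (by rw [Real.dist_eq, sub_zero, abs_of_pos hd]; linarith)
  have hunit : ∀ m ∈ Icc (3:ℝ) 5, IsUnit (N (d, m)) := by
    intro m hm
    refine isUnit_one_sub_of_norm_lt_one ?_
    calc ‖d • (K0 + m • K1)‖ = |d| * ‖K0 + m • K1‖ := by rw [norm_smul, Real.norm_eq_abs]
      _ ≤ |d| * (‖K0‖ + 5 * ‖K1‖) := by
        refine mul_le_mul_of_nonneg_left ?_ (abs_nonneg _)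
        refine (norm_add_le _ _).trans ?_
        rw [norm_smul, Real.norm_eq_abs, abs_of_nonneg (by linarith [hm.1])]
        gcongr
        exact hm.2
      _ < 1 := gU
  have hc : ContinuousOn (fun m : ℝ => G (d, m)) (Icc 3 5) := by
    intro m hm
    refine ContinuousAt.continuousWithinAt ?_
    exact ContinuousAt.comp (f := fun m : ℝ => (d, m)) (hG _ (hunit m hm)) (by fun_prop)
  obtain ⟨m, hm, hm0⟩ := intermediate_value_Icc (by norm_num) hc ⟨g3.le, g5.le⟩
  refine ⟨m, hm.1, Z (d, m), ?_, hm0⟩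
  have h1 : N (d, m) (Z (d, m)) = z0 := by
    have := Ring.mul_inverse_cancel _ (hunit m hm)
    have := congrArg (fun A : Y →L[ℝ] Y => A z0) this
    simpa using this
  have h2 : N (d, m) (Z (d, m)) = Z (d, m) - d • (K0 (Z (d, m)) + m • K1 (Z (d, m))) := by
    simp [N]
  rw [h2] at h1
  rw [← h1]; abel

/-! ### Even extension -/
lemma even_ext {P P1 P2 : ℝ → ℝ} (h1 : ∀ x, 0 ≤ x → HasDerivAt P (P1 x) x)
    (h2 : ∀ x, 0 ≤ x → HasDerivAt P1 (P2 x) x) (h0 : P1 0 = 0) :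
    ∃ U1 : ℝ → ℝ, (∀ x, |U1 x| = |P1 (|x|)|) ∧ (∀ x, HasDerivAt (fun x => P |x|) (U1 x) x) ∧
      (∀ x, HasDerivAt U1 (P2 |x|) x) := by
  have key : ∀ (f f1 g g1 F : ℝ → ℝ), (∀ x, 0 ≤ x → HasDerivAt f (f1 x) x) →
      (∀ x, x ≤ 0 → HasDerivAt g (g1 x) x) → (f1 0 = g1 0) →
      (∀ x, 0 ≤ x → F x = f x) → (∀ x, x ≤ 0 → F x = g x) →
      ∀ x, HasDerivAt F (if 0 ≤ x then f1 x else g1 x) x := by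
    intro f f1 g g1 F hf hg h0 hF hG x
    rcases lt_trichotomy x 0 with hx | hx | hx
    · rw [if_neg (not_le.2 hx)]
      exact (hg x hx.le).congr_of_eventuallyEq
        ((eventually_lt_nhds hx).mono fun y hy => hG y hy.le)
    · subst hx
      rw [if_pos le_rfl]
      have a := ((hf 0 le_rfl).hasDerivWithinAt (s := Ici 0)).congr (fun y hy => hF y hy) (hF 0 le_rfl)
      have b := ((hg 0 le_rfl).hasDerivWithinAt (s := Iic 0)).congr (fun y hy => hG y hy) (hG 0 le_rfl)
      rw [← h0] at b
      have := a.union b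
      rw [Ici_union_Iic] at this
      exact hasDerivWithinAt_univ.1 this
    · rw [if_pos hx.le]
      exact (hf x hx.le).congr_of_eventuallyEq
        ((eventually_gt_nhds hx).mono fun y hy => hF y hy.le)
  refine ⟨fun x => if 0 ≤ x then P1 x else -P1 (-x), ?_, ?_, ?_⟩
  · intro x
    beta_reduce
    split_ifs with h
    · rw [abs_of_nonneg h]
    · rw [abs_neg, abs_of_neg (not_le.1 h)]
  · refine key P P1 (fun x => P (-x)) (fun x => -P1 (-x)) _ h1 ?_ (by simp [h0]) ?_ ?_
    · intro x hx
      have := (h1 (-x) (by linarith)).comp x (hasDerivAt_neg x)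
      simpa [Function.comp_def] using this
    · intro x hx; simp [abs_of_nonneg hx]
    · intro x hx; simp [abs_of_nonpos hx]
  · intro x
    have := key P1 P2 (fun x => -P1 (-x)) (fun x => P2 (-x))
      (fun x => if 0 ≤ x then P1 x else -P1 (-x)) h2 ?_ (by simp) ?_ ?_ x
    · refine this.congr_deriv ?_
      split_ifs with h
      · rw [abs_of_nonneg h]
      · rw [abs_of_neg (not_le.1 h)]
    · intro x hx
      have := ((h2 (-x) (by linarith)).comp x (hasDerivAt_neg x)).fun_neg
      simpa [Function.comp_def] using this
    · intro x hx; simp [hx]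
    · intro x hx
      rcases hx.lt_or_eq with h | h
      · simp [h]
      · subst h; simp [h0]

/-! ### Schwartz class -/
lemma schwartz_of_class (C : Set (ℝ → ℂ)) (hd : ∀ f ∈ C, ∃ f' ∈ C, ∀ x, HasDerivAt f (f' x) x)
    (hb : ∀ f ∈ C, ∃ M, ∀ x, ‖f x‖ ≤ M * wt x) (f : ℝ → ℂ) (hf : f ∈ C) :
    ∃ u : SchwartzMap ℝ ℂ, ⇑u = f := by
  have hit : ∀ n, iteratedDeriv n f ∈ C := by
    intro n
    induction n with
    | zero => simpa using hf
    | succ n ih =>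
      obtain ⟨f', hf', h⟩ := hd _ ih
      rw [iteratedDeriv_succ]
      have : deriv (iteratedDeriv n f) = f' := funext fun x => (h x).deriv
      rwa [this]
  have hwt : ∀ k : ℕ, ∃ B, 0 ≤ B ∧ ∀ x : ℝ, |x| ^ k * wt x ≤ B := by
    intro k
    refine ⟨k.factorial * 2 ^ k, by positivity, fun x => ?_⟩
    have h1 := Real.pow_div_factorial_le_exp (|x| / 2) (by positivity) k
    have h2 : Real.exp (|x|/2) * wt x = 1 := by unfold wt; rw [← Real.exp_add]; simp
    have h3 := mul_le_mul_of_nonneg_right h1 (wt_pos x).le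
    rw [h2, div_pow, div_div, div_mul_eq_mul_div, div_le_one (by positivity)] at h3
    linarith
  refine ⟨⟨f, ?_, ?_⟩, rfl⟩
  · refine contDiff_of_differentiable_iteratedDeriv (n := ⊤) fun m _ => ?_
    obtain ⟨f', _, h⟩ := hd _ (hit m)
    exact fun x => (h x).differentiableAt
  · intro k n
    obtain ⟨M, hM⟩ := hb _ (hit n)
    obtain ⟨B, hB0, hB⟩ := hwt k
    refine ⟨|M| * B, fun x => ?_⟩
    rw [norm_iteratedFDeriv_eq_norm_iteratedDeriv, Real.norm_eq_abs]
    calc |x| ^ k * ‖iteratedDeriv n f x‖ ≤ |x| ^ k * (|M| * wt x) := by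
          refine mul_le_mul_of_nonneg_left ((hM x).trans ?_) (by positivity)
          exact mul_le_mul_of_nonneg_right (le_abs_self M) (wt_pos x).le
      _ = |M| * (|x| ^ k * wt x) := by ring
      _ ≤ _ := mul_le_mul_of_nonneg_left (hB x) (abs_nonneg M)

lemma poly_th_bdd (p : Polynomial ℝ) : ∃ M, 0 ≤ M ∧ ∀ x, |p.eval (th x)| ≤ M := by
  have hc : ContinuousOn (fun t => p.eval t) (Icc (-1) 1) := p.continuous.continuousOn
  obtain ⟨M, hM⟩ := isCompact_Icc.exists_bound_of_continuousOn hc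
  refine ⟨|M|, abs_nonneg _, fun x => (hM (th x) ?_).trans (le_abs_self M)⟩
  exact abs_le.1 (abs_th_le x)

open Polynomial in
lemma schwartz_of_system (U U1 V V1 : ℝ → ℝ) (pu pv qu qv : Polynomial ℝ)
    (hU : ∀ x, HasDerivAt U (U1 x) x) (hV : ∀ x, HasDerivAt V (V1 x) x)
    (hU1 : ∀ x, HasDerivAt U1 (pu.eval (th x) * U x + pv.eval (th x) * V x) x)
    (hV1 : ∀ x, HasDerivAt V1 (qu.eval (th x) * U x + qv.eval (th x) * V x) x)
    (M : ℝ) (bU : ∀ x, |U x| ≤ M * wt x) (bV : ∀ x, |V x| ≤ M * wt x)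
    (bU1 : ∀ x, |U1 x| ≤ M * wt x) (bV1 : ∀ x, |V1 x| ≤ M * wt x) :
    (∃ u : SchwartzMap ℝ ℂ, ∀ x, u x = (U x : ℂ)) ∧ (∃ v : SchwartzMap ℝ ℂ, ∀ x, v x = (V x : ℂ)) := by
  let L : Polynomial ℝ → Polynomial ℝ → Polynomial ℝ → Polynomial ℝ → ℝ → ℂ := fun a b c d x =>
    ((a.eval (th x) * U x + b.eval (th x) * U1 x + c.eval (th x) * V x + d.eval (th x) * V1 x : ℝ) : ℂ)
  let C : Set (ℝ → ℂ) := {f | ∃ a b c d, f = L a b c d}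
  have hd : ∀ f ∈ C, ∃ f' ∈ C, ∀ x, HasDerivAt f (f' x) x := by
    rintro f ⟨a, b, c, d, rfl⟩
    let D : Polynomial ℝ → Polynomial ℝ := fun p => derivative p * (1 - X ^ 2)
    have hD : ∀ (p : Polynomial ℝ) x, HasDerivAt (fun x => p.eval (th x)) ((D p).eval (th x)) x := by
      intro p x
      have := (p.hasDerivAt (th x)).comp x (hasDerivAt_th x)
      refine this.congr_deriv ?_
      simp [D, sc_sq]
    refine ⟨L (D a + b * pu + d * qu) (a + D b) (b * pv + D c + d * qv) (c + D d),
      ⟨_, _, _, _, rfl⟩, fun x => ?_⟩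
    have h := ((((hD a x).mul (hU x)).add ((hD b x).mul (hU1 x))).add ((hD c x).mul (hV x))).add
      ((hD d x).mul (hV1 x))
    have h' := h.ofReal_comp
    refine h'.congr_deriv ?_
    simp only [L]
    congr 1
    simp only [eval_add, eval_mul]
    ring
  have hb : ∀ f ∈ C, ∃ M, ∀ x, ‖f x‖ ≤ M * wt x := by
    rintro f ⟨a, b, c, d, rfl⟩
    obtain ⟨Ma, ha0, ha⟩ := poly_th_bdd a
    obtain ⟨Mb, hb0, hb⟩ := poly_th_bdd b
    obtain ⟨Mc, hc0, hc⟩ := poly_th_bdd c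
    obtain ⟨Md, hd0, hd⟩ := poly_th_bdd d
    refine ⟨Ma * M + Mb * M + Mc * M + Md * M, fun x => ?_⟩
    simp only [L]
    rw [Complex.norm_real, Real.norm_eq_abs]
    refine (abs_add_le _ _).trans ?_
    have e1 := mul_le_mul (ha x) (bU x) (abs_nonneg _) ha0
    have e2 := mul_le_mul (hb x) (bU1 x) (abs_nonneg _) hb0
    have e3 := mul_le_mul (hc x) (bV x) (abs_nonneg _) hc0
    have e4 := mul_le_mul (hd x) (bV1 x) (abs_nonneg _) hd0
    rw [← abs_mul] at e1 e2 e3 e4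
    have e5 := abs_add_le (a.eval (th x) * U x + b.eval (th x) * U1 x) (c.eval (th x) * V x)
    have e6 := abs_add_le (a.eval (th x) * U x) (b.eval (th x) * U1 x)
    linarith
  constructor
  · obtain ⟨u, hu⟩ := schwartz_of_class C hd hb (L 1 0 0 0) ⟨_, _, _, _, rfl⟩
    exact ⟨u, fun x => by rw [hu]; simp [L]⟩
  · obtain ⟨u, hu⟩ := schwartz_of_class C hd hb (L 0 0 1 0) ⟨_, _, _, _, rfl⟩
    exact ⟨u, fun x => by rw [hu]; simp [L]⟩

lemma hasDerivAt_th' (x : ℝ) : HasDerivAt th (1 - th x ^ 2) x := sc_sq x ▸ hasDerivAt_th x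

lemma tendsto_sc : Tendsto sc atTop (𝓝 0) := by
  have h : Tendsto (fun x : ℝ => 2 * Real.exp (-x)) atTop (𝓝 0) := by
    simpa using (Real.tendsto_exp_neg_atTop_nhds_zero).const_mul 2
  exact squeeze_zero (fun x => (sc_pos x).le) sc_le_exp h

lemma tendsto_th : Tendsto th atTop (𝓝 1) := by
  have h : Tendsto (fun x : ℝ => 1 - Real.exp (-x) * sc x) atTop (𝓝 (1 - 0 * 0)) :=
    tendsto_const_nhds.sub (Real.tendsto_exp_neg_atTop_nhds_zero.mul tendsto_sc)
  have e : (fun x : ℝ => 1 - Real.exp (-x) * sc x) = th := by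
    ext x
    rw [← Real.cosh_sub_sinh, sub_mul, cosh_mul_sc]
    unfold th sc; ring
  rw [e] at h
  simpa using h

lemma tendsto_wt : Tendsto wt atTop (𝓝 0) := by
  unfold wt
  refine Real.tendsto_exp_atBot.comp ?_
  refine tendsto_neg_atTop_atBot.comp ?_
  exact tendsto_abs_atTop_atTop.atTop_div_const two_pos

lemma tendsto_xsc : Tendsto (fun x => x * sc x ^ 2) atTop (𝓝 0) := by
  refine squeeze_zero_norm (a := fun x => 4 * wt x) (fun x => ?_) (by simpa using tendsto_wt.const_mul 4)
  rw [norm_mul, Real.norm_eq_abs, Real.norm_of_nonneg (by positivity)]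
  refine le_trans ?_ (abs_mul_sc_le x)
  refine mul_le_mul_of_nonneg_left ?_ (abs_nonneg x)
  nlinarith [sc_pos x, sc_le_one x]

lemma rr_sc : rr 1 sc 0 = 1 := by
  have hw : Wb 2 sc := ⟨continuous_sc, fun x => by rw [abs_of_pos (sc_pos x)]; exact sc_le_wt x⟩
  unfold rr
  rw [integral_Ioi_of_hasDerivAt_of_tendsto (f := th) (m := 1) continuous_th.continuousWithinAt
    (fun x _ => (hasDerivAt_th x).congr_deriv (by ring)) (hw.integrableOn 1 le_rfl) tendsto_th]
  simp [th_zero]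

lemma rr_S0 : rr 1 S0 0 = 1 / 4 := by
  have hw : Wb 3 S0 := ⟨continuous_S0, abs_S0_le⟩
  have hd : ∀ x, HasDerivAt (fun x => (th x + x * sc x ^ 2) / 4) (sc x ^ 1 * S0 x) x := by
    intro x
    have h := ((hasDerivAt_th x).add ((hasDerivAt_id x).mul ((hasDerivAt_sc x).fun_pow 2))).div_const 4
    refine h.congr_deriv ?_
    unfold S0
    simp only [id]
    push_cast
    ring
  have ht : Tendsto (fun x => (th x + x * sc x ^ 2) / 4) atTop (𝓝 ((1 + 0) / 4)) :=
    (tendsto_th.add tendsto_xsc).div_const 4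
  unfold rr
  rw [integral_Ioi_of_hasDerivAt_of_tendsto (hd 0).continuousAt.continuousWithinAt
    (fun x _ => hd x) (hw.integrableOn 1 le_rfl) ht]
  simp [th_zero]

lemma abs_mul_le_of {a b B : ℝ} (ha : |a| ≤ 1) (hb : |b| ≤ B) : |a * b| ≤ B := by
  rw [abs_mul]
  nlinarith [abs_nonneg a, abs_nonneg b]

lemma abs_poly_th (x : ℝ) : |1 - 2 * th x ^ 2| ≤ 1 := by
  have := sq_le_one_iff_abs_le_one (th x) |>.2 (abs_th_le x)
  rw [abs_le]; constructor <;> nlinarith [sq_nonneg (th x)]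

lemma hasDerivAt_ph (x : ℝ) : HasDerivAt ph (sc x * (1 - 2 * th x ^ 2)) x := by
  have h := (hasDerivAt_sc x).mul (hasDerivAt_th' x)
  exact h.congr_deriv (by ring)

lemma io_zero (g : XX) : io g 0 = g 0 := by simp [io, wt]

/-- the minus equation on the half line -/
lemma half_minus (d : ℝ) (h rh : ℝ → ℝ) {Nr Nh : ℝ} (hh : Wb Nh h) (hr : Wb Nr rh)
    (hrh : ∀ x, 0 ≤ x → rh x = rr 1 h x) (h0 : rh 0 = 0) :
    ∃ U1 M, (∀ x, |U1 x| ≤ M * wt x) ∧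
      (∀ x, HasDerivAt (fun x => sc |x| + d * nu rh |x|) (U1 x) x) ∧
      (∀ x, HasDerivAt U1 ((1 - 2 * (1 - th |x| ^ 2)) * (sc |x| + d * nu rh |x|) - d * h |x|) x) := by
  let P1 : ℝ → ℝ := fun x => -(sc x * th x) + d * (rr 1 h x - th x * nu rh x)
  have q1 : ∀ x, 0 ≤ x → HasDerivAt (fun x => sc x + d * nu rh x) (P1 x) x := by
    intro x hx
    have := (hasDerivAt_sc x).add ((hasDerivAt_nu hr.1 x).const_mul d)
    refine this.congr_deriv ?_
    rw [hrh x hx]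
  have q2 : ∀ x, 0 ≤ x → HasDerivAt P1 ((fun x => (1 - 2 * (1 - th x ^ 2)) * (sc x + d * nu rh x) - d * h x) x) x := by
    intro x hx
    have := (((hasDerivAt_sc x).mul (hasDerivAt_th' x)).fun_neg).add
      (((hasDerivAt_rr (k := 1) hh.1 x).sub ((hasDerivAt_th' x).mul (hasDerivAt_nu hr.1 x))).const_mul d)
    refine this.congr_deriv ?_
    beta_reduce
    rw [hrh x hx]
    push_cast
    ring
  have q3 : P1 0 = 0 := by
    simp only [P1]
    rw [← hrh 0 le_rfl, h0, nu_zero, th_zero]; ring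
  obtain ⟨U1, hU, h1, h2⟩ := even_ext q1 q2 q3
  refine ⟨U1, 2 + |d| * (2 * Nh + 4 * Nr), fun x => ?_, h1, h2⟩
  rw [hU, ← wt_abs x]
  have hx := abs_nonneg x
  generalize |x| = y at hx
  have b1 : |th y * sc y| ≤ 2 * wt y := abs_mul_le_of (abs_th_le y)
    (by rw [abs_of_pos (sc_pos y)]; exact sc_le_wt y)
  have b2 : |rr 1 h y| ≤ 2 * Nh * wt y := abs_rr_le hh hx
  have b3 : |th y * nu rh y| ≤ 4 * Nr * wt y := abs_mul_le_of (abs_th_le y) (abs_nu_le hr hx)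
  have b4 : |rr 1 h y - th y * nu rh y| ≤ (2 * Nh + 4 * Nr) * wt y := by
    refine (abs_sub _ _).trans ?_
    linarith
  have b5 : |d * (rr 1 h y - th y * nu rh y)| ≤ |d| * ((2 * Nh + 4 * Nr) * wt y) := by
    rw [abs_mul]; exact mul_le_mul_of_nonneg_left b4 (abs_nonneg d)
  refine (abs_add_le _ _).trans ?_
  rw [abs_neg, mul_comm (sc y)]
  linarith

/-- the plus equation on the half line -/
lemma half_plus (d : ℝ) (k g w : ℝ → ℝ) {Nk Ng Nw : ℝ} (hk : Wb Nk k) (hg : Wb Ng g) (hw : Wb Nw w)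
    (hgk : ∀ x, 0 ≤ x → g x = rr 2 k x) (hwg : ∀ x, 0 ≤ x → w x = rr 1 g x) (P : ℝ → ℝ)
    (hP : P = fun x => S0 x - d * (3 * (th x * nu w x) - rr 1 g x - g 0 * ph x)) :
    ∃ U1 M, (∀ x, |U1 x| ≤ M * wt x) ∧
      (∀ x, HasDerivAt (fun x => P |x|) (U1 x) x) ∧
      (∀ x, HasDerivAt U1 ((1 - 6 * (1 - th |x| ^ 2)) * P |x| + sc |x| + d * k |x|) x) := by
  let P1 : ℝ → ℝ := fun x => (-(sc x * th x) - x * (sc x * (1 - 2 * th x ^ 2)) / 2)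
    - d * (3 * ((1 - 2 * th x ^ 2) * nu w x) + 2 * (th x * rr 1 g x) + rr 2 k x
      - g 0 * (sc x * (1 - 2 * th x ^ 2)))
  have q1 : ∀ x, 0 ≤ x → HasDerivAt (P) (P1 x) x := by
    intro x hx
    rw [hP]
    have hS : HasDerivAt S0 (-(sc x * th x) - x * (sc x * (1 - 2 * th x ^ 2)) / 2) x := by
      have := ((hasDerivAt_sc x).sub ((hasDerivAt_id x).mul (hasDerivAt_ph x))).div_const 2
      refine this.congr_deriv ?_
      simp only [id, ph]
      ring
    have := hS.sub (((((hasDerivAt_th' x).mul (hasDerivAt_nu hw.1 x)).const_mul 3).sub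
      (hasDerivAt_rr (k := 1) hg.1 x)).sub ((hasDerivAt_ph x).const_mul (g 0)) |>.const_mul d)
    refine this.congr_deriv ?_
    rw [hwg x hx, hgk x hx]
    simp only [P1]
    push_cast
    ring
  have q2 : ∀ x, 0 ≤ x → HasDerivAt P1 ((fun x => (1 - 6 * (1 - th x ^ 2)) * P x + sc x + d * k x) x) x := by
    intro x hx
    have hp : HasDerivAt (fun x => 1 - 2 * th x ^ 2) (-(4 * th x * (1 - th x ^ 2))) x := by
      have := (((hasDerivAt_th' x).fun_pow 2).const_mul 2).const_sub 1
      refine this.congr_deriv ?_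
      push_cast
      ring
    have hq := (hasDerivAt_sc x).mul hp
    have := (((hasDerivAt_sc x).mul (hasDerivAt_th' x)).fun_neg.sub
      (((hasDerivAt_id x).mul hq).div_const 2)).sub
      ((((((hp.mul (hasDerivAt_nu hw.1 x)).const_mul 3).add
        (((hasDerivAt_th' x).mul (hasDerivAt_rr (k := 1) hg.1 x)).const_mul 2)).add
        (hasDerivAt_rr (k := 2) hk.1 x)).sub (hq.const_mul (g 0))).const_mul d)
    refine this.congr_deriv ?_
    beta_reduce
    rw [hwg x hx, hgk x hx, hP]
    simp only [id, S0, ph, Pi.mul_apply]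
    push_cast
    ring
  have q3 : P1 0 = 0 := by
    simp only [P1]
    rw [← hgk 0 le_rfl, nu_zero, th_zero, sc_zero]; ring
  obtain ⟨U1, hU, h1, h2⟩ := even_ext q1 q2 q3
  refine ⟨U1, 4 + |d| * (12 * Nw + 4 * Ng + 2 * Nk + 2 * |g 0|), fun x => ?_, h1, h2⟩
  rw [hU, ← wt_abs x]
  have hx := abs_nonneg x
  generalize |x| = y at hx
  have b0 : |sc y| ≤ 2 * wt y := by rw [abs_of_pos (sc_pos y)]; exact sc_le_wt y
  have b1 : |th y * sc y| ≤ 2 * wt y := abs_mul_le_of (abs_th_le y) b0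
  have b2 : |(1 - 2 * th y ^ 2) * (y * sc y)| ≤ 4 * wt y := abs_mul_le_of (abs_poly_th y) (by
    rw [abs_mul, abs_of_pos (sc_pos y)]; exact abs_mul_sc_le y)
  have b3 : |(1 - 2 * th y ^ 2) * nu w y| ≤ 4 * Nw * wt y :=
    abs_mul_le_of (abs_poly_th y) (abs_nu_le hw hx)
  have b4 : |th y * rr 1 g y| ≤ 2 * Ng * wt y := abs_mul_le_of (abs_th_le y) (abs_rr_le hg hx)
  have b5 : |rr 2 k y| ≤ 2 * Nk * wt y := abs_rr_le hk hx
  have b6 : |g 0 * ((1 - 2 * th y ^ 2) * sc y)| ≤ |g 0| * (2 * wt y) := by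
    rw [abs_mul]
    exact mul_le_mul_of_nonneg_left (abs_mul_le_of (abs_poly_th y) b0) (abs_nonneg _)
  have b7 : |3 * ((1 - 2 * th y ^ 2) * nu w y) + 2 * (th y * rr 1 g y) + rr 2 k y
    - g 0 * ((1 - 2 * th y ^ 2) * sc y)| ≤ (12 * Nw + 4 * Ng + 2 * Nk + 2 * |g 0|) * wt y := by
    rw [abs_le] at *
    constructor <;> linarith
  have b8 : |d * (3 * ((1 - 2 * th y ^ 2) * nu w y) + 2 * (th y * rr 1 g y) + rr 2 k y
    - g 0 * ((1 - 2 * th y ^ 2) * sc y))| ≤ |d| * ((12 * Nw + 4 * Ng + 2 * Nk + 2 * |g 0|) * wt y) := by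
    rw [abs_mul]; exact mul_le_mul_of_nonneg_left b7 (abs_nonneg d)
  have e : P1 y = -(th y * sc y) - ((1 - 2 * th y ^ 2) * (y * sc y)) / 2
     - d * (3 * ((1 - 2 * th y ^ 2) * nu w y) + 2 * (th y * rr 1 g y) + rr 2 k y
    - g 0 * ((1 - 2 * th y ^ 2) * sc y)) := by simp only [P1]; ring
  rw [e, abs_le]
  have c1 := abs_le.1 b1
  have c2 := abs_le.1 b2
  have c3 := abs_le.1 b8
  constructor <;> linarith [c1.1, c1.2, c2.1, c2.2, c3.1, c3.2]

open Polynomial in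
lemma exists_core : ∃ d0 : ℝ, 0 < d0 ∧ ∀ d : ℝ, 0 < d → d ≤ d0 → ∃ m : ℝ, 3 ≤ m ∧
    ∃ U U1 V V1 : ℝ → ℝ, V 0 = 1 ∧
    (∀ x, HasDerivAt U (U1 x) x) ∧ (∀ x, HasDerivAt V (V1 x) x) ∧
    (∀ x, HasDerivAt U1 ((1 + d - 6 * sc x ^ 2) * U x + V x) x) ∧
    (∀ x, HasDerivAt V1 ((1 + d - 2 * sc x ^ 2) * V x - d * m * U x) x) ∧
    (∃ u : SchwartzMap ℝ ℂ, ∀ x, u x = (U x : ℂ)) ∧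
    (∃ v : SchwartzMap ℝ ℂ, ∀ x, v x = (V x : ℂ)) := by
  obtain ⟨R1, hR1⟩ := exists_R 1
  obtain ⟨R2, hR2⟩ := exists_R 2
  obtain ⟨A, hA⟩ := exists_V
  obtain ⟨T, hT⟩ := exists_T
  obtain ⟨e, he⟩ := exists_e
  obtain ⟨f, hf⟩ := exists_ph
  obtain ⟨s, hs⟩ := exists_s
  let ev : XX →L[ℝ] ℝ := BoundedContinuousFunction.evalCLM ℝ (0:ℝ)
  have hev : ∀ g, ev g = io g 0 := fun g => (io_zero g).symm
  let Gm : XX →L[ℝ] XX := A ∘L R1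
  let Gp : XX →L[ℝ] XX := (3:ℝ) • (T ∘L A ∘L R1 ∘L R2) - R1 ∘L R2 - (ev ∘L R2).smulRight f
  let p1 := ContinuousLinearMap.fst ℝ XX XX
  let p2 := ContinuousLinearMap.snd ℝ XX XX
  let K0 : XX × XX →L[ℝ] XX × XX := (-(Gp ∘L (p1 - Gm ∘L p2))).prod (-(Gm ∘L p2))
  let K1 : XX × XX →L[ℝ] XX × XX := (-(Gp ∘L (Gm ∘L p1))).prod (Gm ∘L p1)
  have h1 : io s = S0 := funext hs
  have h2 : io e = sc := funext he
  have E1 : (-(ev ∘L R1 ∘L p2)) (s, e) = -1 := by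
    change -(ev (R1 e)) = -1
    rw [hev, hR1, h2, abs_zero, rr_sc]
  have E2 : (ev ∘L R1 ∘L p1) (s, e) = 1 / 4 := by
    change (ev (R1 s)) = 1 / 4
    rw [hev, hR1, h1, abs_zero, rr_S0]
  obtain ⟨d0, hd0, H⟩ := abs_pert K0 K1 (-(ev ∘L R1 ∘L p2)) (ev ∘L R1 ∘L p1) (s, e)
    (by rw [E1, E2]; norm_num) (by rw [E1, E2]; norm_num)
  refine ⟨d0, hd0, fun d hd hd' => ?_⟩
  obtain ⟨m, hm, ⟨p, v⟩, hz, hF⟩ := H d hd hd'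
  refine ⟨m, hm, ?_⟩
  let h : XX := m • p - v
  let k : XX := Gm h + p
  have hv : v = e + d • Gm h := by
    have := congrArg Prod.snd hz
    change v = e + d • (-(Gm v) + m • Gm p) at this
    refine this.trans ?_
    simp only [h, map_sub, map_smul]
    module
  have hp : p = s - d • Gp k := by
    have := congrArg Prod.fst hz
    change p = s + d • (-(Gp (p - Gm v)) + m • (-(Gp (Gm p)))) at this
    refine this.trans ?_
    simp only [h, k, map_sub, map_smul, map_add]
    module
  have h00 : io (R1 h) 0 = 0 := by
    rw [← hev]
    simp only [h, map_sub, map_smul]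
    change -(ev (R1 v)) + m * ev (R1 p) = 0 at hF
    rw [smul_eq_mul]; linarith
  obtain ⟨V1, MV, bV1, hV, hV1⟩ := half_minus d (io h) (io (R1 h)) (wb_io h) (wb_io (R1 h))
    (fun x hx => by rw [hR1, abs_of_nonneg hx]) h00
  obtain ⟨U1, MU, bU1, hU, hU1⟩ := half_plus d (io k) (io (R2 k)) (io (R1 (R2 k))) (wb_io _) (wb_io _)
    (wb_io _) (fun x hx => by rw [hR2, abs_of_nonneg hx]) (fun x hx => by rw [hR1, abs_of_nonneg hx]) _ rfl
  have eV : ∀ x, io v |x| = sc |x| + d * nu (io (R1 h)) |x| := by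
    intro x
    rw [hv, io_add, io_smul, he]
    simp only [Gm, ContinuousLinearMap.comp_apply]
    rw [hA, abs_abs]
  have eU : ∀ x, io p |x| = S0 |x| - d * (3 * (th |x| * nu (io (R1 (R2 k))) |x|)
      - rr 1 (io (R2 k)) |x| - io (R2 k) 0 * ph |x|) := by
    intro x
    rw [hp, io_sub, io_smul, hs]
    have : Gp k = (3:ℝ) • T (A (R1 (R2 k))) - R1 (R2 k) - ev (R2 k) • f := rfl
    rw [this, io_sub, io_sub, io_smul, io_smul, hT, hA, hR1, hf, hev]
    simp only [abs_abs]
  have ek : ∀ x, d * io k |x| = io v |x| - sc |x| + d * io p |x| := by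
    intro x
    simp only [k]
    rw [io_add, hv, io_add, io_smul, he]; ring
  have eh : ∀ x, io h |x| = m * io p |x| - io v |x| := by
    intro x; simp only [h]; rw [io_sub, io_smul]
  have hU' : ∀ x, HasDerivAt (fun x => io p |x|) (U1 x) x := by
    intro x; simp only [eU]; exact hU x
  have hV' : ∀ x, HasDerivAt (fun x => io v |x|) (V1 x) x := by
    intro x; simp only [eV]; exact hV x
  have hU1' : ∀ x, HasDerivAt U1 ((1 + d - 6 * sc x ^ 2) * io p |x| + io v |x|) x := by
    intro x
    refine (hU1 x).congr_deriv ?_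
    beta_reduce
    rw [← eU, ek, th_abs_sq, sc_sq]; ring
  have hV1' : ∀ x, HasDerivAt V1 ((1 + d - 2 * sc x ^ 2) * io v |x| - d * m * io p |x|) x := by
    intro x
    refine (hV1 x).congr_deriv ?_
    rw [← eV, eh, th_abs_sq, sc_sq]; ring
  have hbd : ∀ x, 0 ≤ wt x := fun x => (wt_pos x).le
  have hS := schwartz_of_system (fun x => io p |x|) U1 (fun x => io v |x|) V1
    (C (1 + d) - 6 * (1 - X ^ 2)) 1 (C (-(d * m))) (C (1 + d) - 2 * (1 - X ^ 2)) hU' hV'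
    (fun x => (hU1' x).congr_deriv (by rw [sc_sq]; simp))
    (fun x => (hV1' x).congr_deriv (by rw [sc_sq]; simp; ring))
    (|MU| + |MV| + ‖p‖ + ‖v‖)
    (fun x => by
      have := abs_io_le p |x|
      rw [wt_abs] at this
      refine this.trans (mul_le_mul_of_nonneg_right ?_ (hbd x))
      linarith [abs_nonneg MU, abs_nonneg MV, norm_nonneg v])
    (fun x => by
      have := abs_io_le v |x|
      rw [wt_abs] at this
      refine this.trans (mul_le_mul_of_nonneg_right ?_ (hbd x))
      linarith [abs_nonneg MU, abs_nonneg MV, norm_nonneg p])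
    (fun x => (bU1 x).trans (mul_le_mul_of_nonneg_right
      (by linarith [le_abs_self MU, abs_nonneg MV, norm_nonneg v, norm_nonneg p]) (hbd x)))
    (fun x => (bV1 x).trans (mul_le_mul_of_nonneg_right
      (by linarith [le_abs_self MV, abs_nonneg MU, norm_nonneg v, norm_nonneg p]) (hbd x)))
  refine ⟨fun x => io p |x|, U1, fun x => io v |x|, V1, ?_, hU', hV', hU1', hV1', hS.1, hS.2⟩
  simp only [eV]
  rw [abs_zero, nu_zero, sc_zero]; ring

lemma Q_sq (x : ℝ) : ((Q x : ℝ) : ℂ) ^ 2 = ((2 * sc x ^ 2 : ℝ) : ℂ) := by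
  have : Q x ^ 2 = 2 * sc x ^ 2 := by
    simp only [Q, sc]
    rw [div_pow, Real.sq_sqrt (by norm_num), inv_pow, div_eq_mul_inv]
  rw [← this]; push_cast; ring

lemma iter_two {f : ℝ → ℂ} {F F1 F2 : ℝ → ℝ} (hf : ∀ x, f x = (F x : ℂ))
    (h1 : ∀ x, HasDerivAt F (F1 x) x) (h2 : ∀ x, HasDerivAt F1 (F2 x) x) (x : ℝ) :
    iteratedDeriv 2 f x = (F2 x : ℂ) := by
  have e : f = fun x => (F x : ℂ) := funext hf
  have e1 : deriv f = fun x => (F1 x : ℂ) := by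
    funext y; rw [e]; exact (h1 y).ofReal_comp.deriv
  rw [iteratedDeriv_succ, iteratedDeriv_one, e1]
  exact (h2 x).ofReal_comp.deriv

lemma exists_unstable : ∃ e0 : ℝ, 0 < e0 ∧ ∀ e : ℝ, 0 < e → e ≤ e0 →
    ∃ s : ℂ, IsUnstableEigenvalue e s := by
  obtain ⟨d0, hd0, H⟩ := exists_core
  refine ⟨√d0, Real.sqrt_pos.2 hd0, fun e he hle => ?_⟩
  have hd : e ^ 2 ≤ d0 := by
    rw [← Real.sq_sqrt hd0.le]; gcongr
  obtain ⟨m, hm, U, U1, V, V1, hV0, hU, hV, hU1, hV1, ⟨u, hu⟩, ⟨v, hv⟩⟩ := H (e ^ 2) (by positivity) hd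
  have hs : (√m) ^ 2 = m := Real.sq_sqrt (by linarith)
  have hsp : 0 < √m := Real.sqrt_pos.2 (by linarith)
  refine ⟨((e * √m : ℝ) : ℂ), ?_, ((e * √m : ℝ) : ℂ) • u, v, Or.inr ?_, ?_, ?_⟩
  · rw [Complex.ofReal_re]; positivity
  · intro h
    have := hv 0
    rw [h, hV0] at this
    simp at this
  · intro x
    have hf : ∀ x, (((e * √m : ℝ) : ℂ) • u) x = ((e * √m * U x : ℝ) : ℂ) := by
      intro x; rw [smul_apply, hu]; push_cast; simp
    rw [iter_two hf (fun x => (hU x).const_mul _) (fun x => (hU1 x).const_mul _), hf, hv, Q_sq]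
    norm_cast
    ring
  · intro x
    rw [iter_two hv hV hV1, hv, Q_sq, smul_apply, hu, smul_eq_mul]
    norm_cast
    linear_combination (-(e^2 * U x)) * hs

lemma pos_of_W (W W' h : ℝ → ℝ) (hc : Continuous W) (hd : ∀ x, x ≠ 0 → HasDerivAt W (W' x) x)
    (hl : Tendsto W (cocompact ℝ) (𝓝 0)) (hi : Integrable h) (hle : ∀ x, x ≠ 0 → -W' x ≤ h x) :
    0 ≤ ∫ x, h x := by
  have key : ∀ b : ℝ, 0 ≤ b → W (-b) - W b ≤ ∫ x in (-b)..b, h x := by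
    intro b hb
    have h1 := intervalIntegral.sub_le_integral_of_hasDeriv_right_of_le (g := fun x => - W x)
      (g' := fun x => - W' x) (φ := h) hb hc.neg.continuousOn
      (fun x hx => (hd x hx.1.ne').fun_neg.hasDerivWithinAt) hi.integrableOn
      (fun x hx => hle x hx.1.ne')
    have h2 := intervalIntegral.sub_le_integral_of_hasDeriv_right_of_le (g := fun x => - W x)
      (g' := fun x => - W' x) (φ := h) (neg_nonpos.2 hb) hc.neg.continuousOn
      (fun x hx => (hd x hx.2.ne).fun_neg.hasDerivWithinAt) hi.integrableOn
      (fun x hx => hle x hx.2.ne)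
    have h3 := intervalIntegral.integral_add_adjacent_intervals (f := h) (a := -b) (b := 0) (c := b)
      (μ := volume) hi.intervalIntegrable hi.intervalIntegrable
    linarith
  have t1 : Tendsto (fun b : ℝ => W (-b) - W b) atTop (𝓝 (0 - 0)) := by
    have ha : Tendsto W atTop (𝓝 0) := hl.mono_left atTop_le_cocompact
    have hb : Tendsto W atBot (𝓝 0) := hl.mono_left atBot_le_cocompact
    exact (hb.comp tendsto_neg_atTop_atBot).sub ha
  have t2 : Tendsto (fun b : ℝ => ∫ x in (-b)..b, h x) atTop (𝓝 (∫ x, h x)) :=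
    intervalIntegral_tendsto_integral hi tendsto_neg_atTop_atBot tendsto_id
  rw [sub_zero] at t1
  refine le_of_tendsto_of_tendsto t1 t2 ?_
  filter_upwards [eventually_ge_atTop 0] with b hb using key b hb

noncomputable def dS (f : SchwartzMap ℝ ℂ) : SchwartzMap ℝ ℂ := SchwartzMap.derivCLM ℂ ℂ f

lemma hasDerivAt_dS (f : SchwartzMap ℝ ℂ) (x : ℝ) : HasDerivAt f (dS f x) x := by
  rw [dS, SchwartzMap.derivCLM_apply]
  exact f.differentiableAt.hasDerivAt

lemma iter_dS (f : SchwartzMap ℝ ℂ) (x : ℝ) : iteratedDeriv 2 (⇑f) x = dS (dS f) x := by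
  have e1 : deriv f = dS f := by
    funext y; exact (hasDerivAt_dS f y).deriv
  rw [iteratedDeriv_succ, iteratedDeriv_one, e1]
  exact (hasDerivAt_dS _ x).deriv

lemma hasDerivAt_re {f : ℝ → ℂ} {f' : ℂ} {x : ℝ} (h : HasDerivAt f f' x) :
    HasDerivAt (fun x => (f x).re) f'.re x :=
  Complex.reCLM.hasFDerivAt.comp_hasDerivAt x h

lemma hasDerivAt_im {f : ℝ → ℂ} {f' : ℂ} {x : ℝ} (h : HasDerivAt f f' x) :
    HasDerivAt (fun x => (f x).im) f'.im x :=
  Complex.imCLM.hasFDerivAt.comp_hasDerivAt x h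

lemma int_mul (f g : SchwartzMap ℝ ℂ) : Integrable (fun x => f x * g x) := by
  have h := g.integrable (μ := volume)
  refine h.bdd_mul (c := ‖f.toBoundedContinuousFunction‖) f.continuous.aestronglyMeasurable ?_
  filter_upwards with x using f.toBoundedContinuousFunction.norm_coe_le_norm x

noncomputable def cS (f : SchwartzMap ℝ ℂ) : SchwartzMap ℝ ℂ :=
  f.postcompCLM (Complex.conjCLE : ℂ →L[ℝ] ℂ)

lemma cS_apply (f : SchwartzMap ℝ ℂ) (x : ℝ) : cS f x = (starRingEnd ℂ) (f x) := rfl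

lemma dS_cS (f : SchwartzMap ℝ ℂ) (x : ℝ) : dS (cS f) x = (starRingEnd ℂ) (dS f x) := by
  have h1 : HasDerivAt (cS f) ((starRingEnd ℂ) (dS f x)) x :=
    (Complex.conjCLE : ℂ →L[ℝ] ℂ).hasFDerivAt.comp_hasDerivAt x (hasDerivAt_dS f x)
  exact (hasDerivAt_dS _ x).unique h1

lemma symm_dd (f g : SchwartzMap ℝ ℂ) : ∫ x, dS (dS f) x * g x = ∫ x, f x * dS (dS g) x := by
  have e : ∀ k : SchwartzMap ℝ ℂ, ∀ x, dS k x = deriv k x := fun k x => rfl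
  have h1 := SchwartzMap.integral_mul_deriv_eq_neg_deriv_mul f (dS g)
  have h2 := SchwartzMap.integral_mul_deriv_eq_neg_deriv_mul (dS f) g
  simp only [← e] at h1 h2
  rw [h1, h2]; simp

/-- the eigenvalue system -/
def Sys (e : ℝ) (s : ℂ) (u v : SchwartzMap ℝ ℂ) : Prop :=
  (∀ x, -dS (dS u) x + u x - 6 * (sc x : ℂ) ^ 2 * u x + (e : ℂ) ^ 2 * u x = -s * v x) ∧
  (∀ x, -dS (dS v) x + v x - 2 * (sc x : ℂ) ^ 2 * v x + (e : ℂ) ^ 2 * v x = s * u x)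

lemma Sys.conj {e : ℝ} {s : ℂ} {u v : SchwartzMap ℝ ℂ} (h : Sys e s u v) :
    Sys e ((starRingEnd ℂ) s) (cS u) (cS v) := by
  have e2 : ∀ f x, dS (dS (cS f)) x = (starRingEnd ℂ) (dS (dS f) x) := by
    intro f x
    have : dS (cS f) = cS (dS f) := by ext y; rw [dS_cS, cS_apply]
    rw [this, dS_cS]
  constructor
  · intro x
    have := congrArg (starRingEnd ℂ) (h.1 x)
    simp only [map_add, map_sub, map_mul, map_neg, map_pow, Complex.conj_ofReal, map_ofNat] at this
    rw [e2, cS_apply, cS_apply]; exact this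
  · intro x
    have := congrArg (starRingEnd ℂ) (h.2 x)
    simp only [map_add, map_sub, map_mul, map_neg, map_pow, Complex.conj_ofReal, map_ofNat] at this
    rw [e2, cS_apply, cS_apply]; exact this

lemma Sys.orth {e : ℝ} {s t : ℂ} {u v p q : SchwartzMap ℝ ℂ} (h : Sys e s u v) (k : Sys e t p q)
    (hst : s ^ 2 ≠ t ^ 2) : ∫ x, v x * p x = 0 ∧ ∫ x, u x * q x = 0 := by
  have h1 : s * ∫ x, v x * p x = t * ∫ x, u x * q x := by
    have := symm_dd u p
    rw [← sub_eq_zero, ← integral_sub (int_mul _ _) (int_mul _ _)] at this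
    rw [← sub_eq_zero, ← integral_const_mul, ← integral_const_mul,
      ← integral_sub ((int_mul _ _).const_mul _) ((int_mul _ _).const_mul _), ← this]
    congr 1; funext x
    linear_combination (p x) * h.1 x - u x * k.1 x
  have h2 : s * ∫ x, u x * q x = t * ∫ x, v x * p x := by
    have := symm_dd v q
    rw [← sub_eq_zero, ← integral_sub (int_mul _ _) (int_mul _ _), ← neg_eq_zero, ← integral_neg] at this
    rw [← sub_eq_zero, ← integral_const_mul, ← integral_const_mul,
      ← integral_sub ((int_mul _ _).const_mul _) ((int_mul _ _).const_mul _), ← this]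
    congr 1; funext x
    linear_combination (-q x) * h.2 x + v x * k.2 x
  have hne : s ^ 2 - t ^ 2 ≠ 0 := sub_ne_zero.2 hst
  constructor
  · have : (s ^ 2 - t ^ 2) * ∫ x, v x * p x = 0 := by linear_combination s * h1 + t * h2
    exact (mul_eq_zero.1 this).resolve_left hne
  · have : (s ^ 2 - t ^ 2) * ∫ x, u x * q x = 0 := by linear_combination s * h2 + t * h1
    exact (mul_eq_zero.1 this).resolve_left hne

lemma posB (f g : SchwartzMap ℝ ℂ) (e : ℝ)
    (hg : ∀ x, -dS (dS f) x + f x - 2 * (sc x : ℂ) ^ 2 * f x + (e : ℂ) ^ 2 * f x = g x) :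
    e ^ 2 * (∫ x, f x * cS f x).re ≤ (∫ x, g x * cS f x).re := by
  have hi : Integrable (fun x => g x * cS f x - (e:ℂ) ^ 2 * (f x * cS f x)) :=
    (int_mul _ _).sub ((int_mul _ _).const_mul _)
  have main := pos_of_W (fun x => ((f x).re * (dS f x).re + (f x).im * (dS f x).im)
      + th x * ((f x).re ^ 2 + (f x).im ^ 2))
    (fun x => (((dS f x).re * (dS f x).re + (f x).re * (dS (dS f) x).re) +
      ((dS f x).im * (dS f x).im + (f x).im * (dS (dS f) x).im)) +
      ((1 - th x ^ 2) * ((f x).re ^ 2 + (f x).im ^ 2) +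
        th x * (2 * (f x).re * (dS f x).re + 2 * (f x).im * (dS f x).im)))
    (fun x => (g x * cS f x - (e:ℂ) ^ 2 * (f x * cS f x)).re) ?_ ?_ ?_ hi.re ?_
  · have h2 : ∫ x, (g x * cS f x - (e:ℂ) ^ 2 * (f x * cS f x)).re =
        (∫ x, (g x * cS f x - (e:ℂ) ^ 2 * (f x * cS f x))).re := integral_re hi
    rw [h2, integral_sub (int_mul _ _) ((int_mul _ _).const_mul _), integral_const_mul,
      Complex.sub_re, ← Complex.ofReal_pow, Complex.re_ofReal_mul] at main
    linarith
  · have := f.continuous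
    have := (dS f).continuous
    have := continuous_th
    fun_prop
  · intro x _
    have h1 := hasDerivAt_re (hasDerivAt_dS f x)
    have h2 := hasDerivAt_im (hasDerivAt_dS f x)
    have h3 := hasDerivAt_re (hasDerivAt_dS (dS f) x)
    have h4 := hasDerivAt_im (hasDerivAt_dS (dS f) x)
    refine (((h1.mul h3).add (h2.mul h4)).add ((hasDerivAt_th' x).mul
      ((h1.fun_pow 2).add (h2.fun_pow 2)))).congr_deriv ?_
    simp only [Pi.add_apply]
    push_cast
    ring
  · have a : Tendsto f (cocompact ℝ) (𝓝 0) := zero_at_infty f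
    have b : Tendsto (dS f) (cocompact ℝ) (𝓝 0) := zero_at_infty (dS f)
    have a1 : Tendsto (fun x => (f x).re) (cocompact ℝ) (𝓝 0) := (Complex.continuous_re.tendsto 0).comp a
    have a2 : Tendsto (fun x => (f x).im) (cocompact ℝ) (𝓝 0) := (Complex.continuous_im.tendsto 0).comp a
    have b1 : Tendsto (fun x => (dS f x).re) (cocompact ℝ) (𝓝 0) := (Complex.continuous_re.tendsto 0).comp b
    have b2 : Tendsto (fun x => (dS f x).im) (cocompact ℝ) (𝓝 0) := (Complex.continuous_im.tendsto 0).comp b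
    have c := (a1.pow 2).add (a2.pow 2)
    have c' : Tendsto (fun x => th x * ((f x).re ^ 2 + (f x).im ^ 2)) (cocompact ℝ) (𝓝 0) := by
      refine squeeze_zero_norm (fun x => ?_) (by simpa using c)
      rw [norm_mul, Real.norm_eq_abs, Real.norm_eq_abs, abs_of_nonneg (a := _ + _) (by positivity)]
      exact mul_le_of_le_one_left (by positivity) (abs_th_le x)
    simpa using ((a1.mul b1).add (a2.mul b2)).add c'
  · intro x _
    rw [← hg x, cS_apply]
    have hs := sc_sq x
    simp only [← Complex.ofReal_pow, Complex.sub_re, Complex.mul_re, Complex.add_re, Complex.neg_re,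
      Complex.conj_re, Complex.conj_im, Complex.ofReal_re, Complex.ofReal_im, Complex.mul_im,
      Complex.add_im, Complex.neg_im, Complex.sub_im, Complex.re_ofNat, Complex.im_ofNat]
    rw [hs]
    nlinarith [sq_nonneg ((dS f x).re + th x * (f x).re), sq_nonneg ((dS f x).im + th x * (f x).im)]

lemma inv_th_le (x : ℝ) (hx : x ≠ 0) : |(th x)⁻¹| ≤ 1 + |x|⁻¹ := by
  wlog h : 0 < x with H
  · have h' : 0 < -x := by
      rcases lt_or_gt_of_ne hx with h1 | h1
      · linarith
      · exact absurd h1 h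
    have := H (-x) (neg_ne_zero.2 hx) h'
    have e : th (-x) = - th x := by simp [th]
    rwa [e, abs_neg, inv_neg, abs_neg] at this
  · have h1 : x ≤ Real.sinh x := Real.self_le_sinh_iff.2 h.le
    have h2 : 0 < Real.sinh x := by linarith
    have h3 : Real.cosh x ≤ Real.sinh x + 1 := by
      have := Real.cosh_sub_sinh x
      have h4 : Real.exp (-x) ≤ 1 := by rw [Real.exp_le_one_iff]; linarith
      linarith
    have h5 : (th x)⁻¹ = Real.cosh x / Real.sinh x := by
      simp only [th, mul_inv, inv_inv]; field_simp
    rw [h5, abs_of_nonneg (by positivity), abs_of_pos h]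
    calc Real.cosh x / Real.sinh x ≤ (Real.sinh x + 1) / Real.sinh x := by gcongr
      _ = 1 + (Real.sinh x)⁻¹ := by field_simp
      _ ≤ 1 + x⁻¹ := by gcongr

lemma th_ne {x : ℝ} (hx : x ≠ 0) : th x ≠ 0 := by
  have : Real.sinh x ≠ 0 := by simpa using hx
  exact mul_ne_zero this (inv_ne_zero (Real.cosh_pos x).ne')

lemma lin_bound (f : SchwartzMap ℝ ℂ) (h0 : f 0 = 0) : ∃ C, 0 ≤ C ∧ ∀ x, ‖f x‖ ≤ C * |x| := by
  refine ⟨‖(dS f).toBoundedContinuousFunction‖, norm_nonneg _, fun x => ?_⟩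
  have := Convex.norm_image_sub_le_of_norm_deriv_le (𝕜 := ℝ) (f := f) (s := univ) (x := 0) (y := x)
    (C := ‖(dS f).toBoundedContinuousFunction‖) (fun y _ => f.differentiableAt)
    (fun y _ => (dS f).toBoundedContinuousFunction.norm_coe_le_norm y) convex_univ trivial trivial
  simpa [h0] using this

lemma abs_w_le (f : SchwartzMap ℝ ℂ) {C : ℝ} (hC : 0 ≤ C) (h : ∀ x, ‖f x‖ ≤ C * |x|) (x : ℝ) :
    ‖((th x)⁻¹ - 2 * th x) * ((f x).re ^ 2 + (f x).im ^ 2)‖ ≤ 3 * ‖f x‖ ^ 2 + C * ‖f x‖ := by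
  have e : (f x).re ^ 2 + (f x).im ^ 2 = ‖f x‖ ^ 2 := by
    rw [Complex.sq_norm, Complex.normSq_apply]; ring
  rw [e, norm_mul, norm_pow, norm_norm, Real.norm_eq_abs]
  have ht := abs_th_le x
  have h1 : |(th x)⁻¹ - 2 * th x| ≤ |(th x)⁻¹| + 2 := by
    calc _ ≤ |(th x)⁻¹| + |2 * th x| := abs_sub _ _
      _ ≤ _ := by rw [abs_mul, abs_two]; linarith
  have h2 : |(th x)⁻¹| * ‖f x‖ ≤ ‖f x‖ + C := by
    by_cases hx : x = 0
    · subst hx; simp [th_zero]; positivity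
    · have hx' : 0 < |x| := abs_pos.2 hx
      calc |(th x)⁻¹| * ‖f x‖ ≤ (1 + |x|⁻¹) * ‖f x‖ := by gcongr; exact inv_th_le x hx
        _ = ‖f x‖ + |x|⁻¹ * ‖f x‖ := by ring
        _ ≤ ‖f x‖ + |x|⁻¹ * (C * |x|) := by gcongr; exact h x
        _ = _ := by field_simp
  calc _ ≤ (|(th x)⁻¹| + 2) * ‖f x‖ ^ 2 := by gcongr
    _ = (|(th x)⁻¹| * ‖f x‖) * ‖f x‖ + 2 * ‖f x‖ ^ 2 := by ring
    _ ≤ (‖f x‖ + C) * ‖f x‖ + 2 * ‖f x‖ ^ 2 := by gcongr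
    _ = _ := by ring

lemma posA (f g : SchwartzMap ℝ ℂ) (e : ℝ) (h0 : f 0 = 0)
    (hg : ∀ x, -dS (dS f) x + f x - 6 * (sc x : ℂ) ^ 2 * f x + (e : ℂ) ^ 2 * f x = g x) :
    0 ≤ (∫ x, g x * cS f x).re := by
  have hi : Integrable (fun x => g x * cS f x) := int_mul _ _
  obtain ⟨C, hC, hb⟩ := lin_bound f h0
  have hw := abs_w_le f hC hb
  have main := pos_of_W (fun x => ((f x).re * (dS f x).re + (f x).im * (dS f x).im)
      - ((th x)⁻¹ - 2 * th x) * ((f x).re ^ 2 + (f x).im ^ 2))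
    (fun x => (((dS f x).re * (dS f x).re + (f x).re * (dS (dS f) x).re) +
      ((dS f x).im * (dS f x).im + (f x).im * (dS (dS f) x).im)) -
      ((-(1 - th x ^ 2) / th x ^ 2 - 2 * (1 - th x ^ 2)) * ((f x).re ^ 2 + (f x).im ^ 2) +
        ((th x)⁻¹ - 2 * th x) * (2 * (f x).re * (dS f x).re + 2 * (f x).im * (dS f x).im)))
    (fun x => (g x * cS f x).re) ?_ ?_ ?_ hi.re ?_
  · have h2 : ∫ x, (g x * cS f x).re = (∫ x, g x * cS f x).re := integral_re hi
    rwa [h2] at main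
  · have c1 := f.continuous
    have c2 := (dS f).continuous
    refine Continuous.sub (by fun_prop) ?_
    rw [continuous_iff_continuousAt]
    intro x
    by_cases hx : x = 0
    · subst hx
      rw [ContinuousAt]
      simp only [h0, Complex.zero_re, Complex.zero_im, ne_eq, OfNat.ofNat_ne_zero, not_false_eq_true,
        zero_pow, add_zero, mul_zero]
      refine squeeze_zero_norm hw ?_
      have : Continuous fun x => 3 * ‖f x‖ ^ 2 + C * ‖f x‖ := by fun_prop
      simpa [h0] using this.tendsto 0
    · have ct := continuous_th
      exact ((ct.continuousAt.inv₀ (th_ne hx)).sub (by fun_prop)).mul (by fun_prop)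
  · intro x hx
    have h1 := hasDerivAt_re (hasDerivAt_dS f x)
    have h2 := hasDerivAt_im (hasDerivAt_dS f x)
    have h3 := hasDerivAt_re (hasDerivAt_dS (dS f) x)
    have h4 := hasDerivAt_im (hasDerivAt_dS (dS f) x)
    refine (((h1.mul h3).add (h2.mul h4)).sub ((((hasDerivAt_th' x).fun_inv (th_ne hx)).sub
      ((hasDerivAt_th' x).const_mul 2)).mul
      ((h1.fun_pow 2).add (h2.fun_pow 2)))).congr_deriv ?_
    simp only [Pi.add_apply, Pi.sub_apply]
    push_cast
    ring
  · have a : Tendsto f (cocompact ℝ) (𝓝 0) := zero_at_infty f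
    have b : Tendsto (dS f) (cocompact ℝ) (𝓝 0) := zero_at_infty (dS f)
    have a1 : Tendsto (fun x => (f x).re) (cocompact ℝ) (𝓝 0) := (Complex.continuous_re.tendsto 0).comp a
    have a2 : Tendsto (fun x => (f x).im) (cocompact ℝ) (𝓝 0) := (Complex.continuous_im.tendsto 0).comp a
    have b1 : Tendsto (fun x => (dS f x).re) (cocompact ℝ) (𝓝 0) := (Complex.continuous_re.tendsto 0).comp b
    have b2 : Tendsto (fun x => (dS f x).im) (cocompact ℝ) (𝓝 0) := (Complex.continuous_im.tendsto 0).comp b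
    have c' : Tendsto (fun x => ((th x)⁻¹ - 2 * th x) * ((f x).re ^ 2 + (f x).im ^ 2)) (cocompact ℝ) (𝓝 0) := by
      refine squeeze_zero_norm hw ?_
      simpa using ((a.norm.pow 2).const_mul 3).add (a.norm.const_mul C)
    simpa using ((a1.mul b1).add (a2.mul b2)).sub c'
  · intro x hx
    rw [← hg x, cS_apply]
    have hs := sc_sq x
    simp only [← Complex.ofReal_pow, Complex.sub_re, Complex.mul_re, Complex.add_re, Complex.neg_re,
      Complex.conj_re, Complex.conj_im, Complex.ofReal_re, Complex.ofReal_im, Complex.mul_im,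
      Complex.add_im, Complex.neg_im, Complex.sub_im, Complex.re_ofNat, Complex.im_ofNat]
    rw [hs]
    have ht := th_ne hx
    have p1 := sq_nonneg ((dS f x).re - ((th x)⁻¹ - 2 * th x) * (f x).re)
    have p2 := sq_nonneg ((dS f x).im - ((th x)⁻¹ - 2 * th x) * (f x).im)
    have p3 : 0 ≤ e ^ 2 * ((f x).re ^ 2 + (f x).im ^ 2) := by positivity
    have hr : th x * (th x)⁻¹ = 1 := mul_inv_cancel₀ ht
    rw [neg_div, sub_div, div_self (pow_ne_zero 2 ht), one_div, ← inv_pow]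
    generalize (th x)⁻¹ = r at *
    generalize th x = T at *
    generalize (f x).re = a at *
    generalize (f x).im = b at *
    generalize (dS f x).re = a1 at *
    generalize (dS f x).im = b1 at *
    rw [← sub_nonneg]
    refine (add_nonneg (add_nonneg p1 p2) p3).trans_eq ?_
    linear_combination (-4 * (a ^ 2 + b ^ 2)) * hr

lemma nrm_nonneg_pos (f : SchwartzMap ℝ ℂ) (hf : f ≠ 0) : 0 < (∫ x, f x * cS f x).re := by
  have hi : Integrable (fun x => f x * cS f x) := int_mul _ _
  have h2 : ∫ x, (f x * cS f x).re = (∫ x, f x * cS f x).re := integral_re hi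
  have e : ∀ x, (f x * cS f x).re = ‖f x‖ ^ 2 := by
    intro x; rw [cS_apply, Complex.mul_conj, Complex.ofReal_re, Complex.sq_norm]
  have hir : Integrable (fun x => (f x * cS f x).re) := hi.re
  simp only [e] at h2 hir
  rw [← h2, integral_pos_iff_support_of_nonneg (fun x => by positivity) hir]
  have c : Continuous (fun x => ‖f x‖ ^ 2) := f.continuous.norm.pow 2
  refine c.isOpen_support.measure_pos _ ?_
  by_contra hne
  apply hf
  ext x
  rw [Set.not_nonempty_iff_eq_empty, Function.support_eq_empty_iff] at hne
  simpa using congrFun hne x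

lemma Sys.pos {e : ℝ} (he : 0 < e) {s : ℂ} (hs : 0 < s.re) {u v : SchwartzMap ℝ ℂ} (h : Sys e s u v)
    (hne : u ≠ 0 ∨ v ≠ 0) : 0 < (s * ∫ x, u x * cS v x).re := by
  have hs0 : s ≠ 0 := by rintro rfl; simp at hs
  have hv : v ≠ 0 := by
    intro hv
    have hu : u = 0 := by
      ext x
      have := h.2 x
      have e0 : dS (dS v) x = 0 := by rw [hv]; simp [dS]
      rw [e0, hv] at this
      simpa [hs0] using this
    tauto
  have h1 := posB v (s • u) e (fun x => by rw [smul_apply, smul_eq_mul]; exact h.2 x)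
  have h2 := nrm_nonneg_pos v hv
  have h3 : ∫ x, (s • u) x * cS v x = s * ∫ x, u x * cS v x := by
    rw [← integral_const_mul]; congr 1; funext x; rw [smul_apply, smul_eq_mul]; ring
  rw [h3] at h1
  have : 0 < e ^ 2 * (∫ x, v x * cS v x).re := by positivity
  linarith

lemma Sys.real {e : ℝ} (he : 0 < e) {s : ℂ} (hs : 0 < s.re) {u v : SchwartzMap ℝ ℂ} (h : Sys e s u v)
    (hne : u ≠ 0 ∨ v ≠ 0) : (starRingEnd ℂ) s = s := by
  by_contra hc
  have hp := h.pos he hs hne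
  have : s ^ 2 ≠ ((starRingEnd ℂ) s) ^ 2 := by
    intro h2
    rcases sq_eq_sq_iff_eq_or_eq_neg.1 h2 with h3 | h3
    · exact hc h3.symm
    · have := congrArg Complex.re h3
      simp at this; linarith
  rw [(h.orth h.conj this).2] at hp
  simp at hp

lemma Sys.unique {e : ℝ} (he : 0 < e) {s t : ℂ} (hs : 0 < s.re) (ht : 0 < t.re)
    {u v p q : SchwartzMap ℝ ℂ} (h : Sys e s u v) (k : Sys e t p q)
    (hne : u ≠ 0 ∨ v ≠ 0) (kne : p ≠ 0 ∨ q ≠ 0) : s = t := by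
  by_contra hc
  have rs := h.real he hs hne
  have rt := k.real he ht kne
  have hst : s ^ 2 ≠ t ^ 2 := by
    intro h2
    rcases sq_eq_sq_iff_eq_or_eq_neg.1 h2 with h3 | h3
    · exact hc h3
    · have := congrArg Complex.re h3
      simp at this; linarith
  have o1 := (h.orth (rt ▸ k.conj) hst).1
  have o2 := (k.orth (rs ▸ h.conj) hst.symm).1
  have cj : ∀ a b : SchwartzMap ℝ ℂ, ∫ x, b x * cS a x = (starRingEnd ℂ) (∫ x, a x * cS b x) := by
    intro a b
    rw [← integral_conj]; congr 1; funext x; simp [cS_apply, mul_comm]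
  have d1 : 0 < (s * ∫ x, v x * cS u x).re := by
    have := h.pos he hs hne
    rw [cj, ← Complex.conj_re, map_mul, rs, Complex.conj_conj] at this
    simpa [cj u v] using this
  have d2 : 0 < (t * ∫ x, q x * cS p x).re := by
    have := k.pos he ht kne
    rw [cj, ← Complex.conj_re, map_mul, rt, Complex.conj_conj] at this
    simpa [cj p q] using this
  obtain ⟨a, b, hab, h0⟩ : ∃ a b : ℂ, (a ≠ 0 ∨ b ≠ 0) ∧ a * u 0 + b * p 0 = 0 := by
    by_cases h1 : p 0 = 0
    · by_cases h2 : u 0 = 0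
      · exact ⟨1, 0, by simp, by simp [h2]⟩
      · exact ⟨p 0, -u 0, by simp [h2], by ring⟩
    · exact ⟨p 0, -u 0, by simp [h1], by ring⟩
  have ddl : ∀ x, dS (dS (a • u + b • p)) x = a * dS (dS u) x + b * dS (dS p) x := by
    intro x; simp [dS]
  have A := posA (a • u + b • p) (-((s * a) • v + (t * b) • q)) e (by simpa using h0) (by
    intro x
    rw [ddl]
    simp only [add_apply, smul_apply, neg_apply, smul_eq_mul]
    linear_combination a * h.1 x + b * k.1 x)
  have ex : ∫ x, (-((s * a) • v + (t * b) • q)) x * cS (a • u + b • p) x =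
      -(((a * (starRingEnd ℂ) a) * (s * ∫ x, v x * cS u x) + (s * a * (starRingEnd ℂ) b) * ∫ x, v x * cS p x)
       + ((t * b * (starRingEnd ℂ) a) * (∫ x, q x * cS u x) + (b * (starRingEnd ℂ) b) * (t * ∫ x, q x * cS p x))) := by
    rw [← mul_assoc _ s, ← mul_assoc _ t]
    simp only [← integral_const_mul]
    have i : ∀ (c : ℂ) (f g : SchwartzMap ℝ ℂ), Integrable (fun x => c * (f x * g x)) :=
      fun c f g => (int_mul _ _).const_mul c
    have j : ∀ (c : ℂ) (f g : SchwartzMap ℝ ℂ) (c' : ℂ) (f' g' : SchwartzMap ℝ ℂ),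
        Integrable (fun x => c * (f x * g x) + c' * (f' x * g' x)) :=
      fun c f g c' f' g' => (i c f g).add (i c' f' g')
    rw [← integral_add (i _ _ _) (i _ _ _), ← integral_add (i _ _ _) (i _ _ _),
      ← integral_add (j _ _ _ _ _ _) (j _ _ _ _ _ _), ← integral_neg]
    congr 1; funext x
    simp only [cS_apply, add_apply, smul_apply, neg_apply, smul_eq_mul, map_add, map_mul]
    ring
  rw [ex, o1, o2, Complex.mul_conj, Complex.mul_conj] at A
  simp only [mul_zero, add_zero, zero_add, Complex.neg_re, Complex.add_re, Complex.re_ofReal_mul] at A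
  have na := Complex.normSq_nonneg a
  have nb := Complex.normSq_nonneg b
  rcases hab with ha | hb
  · have := Complex.normSq_pos.2 ha
    have := mul_pos this d1
    have := mul_nonneg nb d2.le
    linarith
  · have := Complex.normSq_pos.2 hb
    have := mul_pos this d2
    have := mul_nonneg na d1.le
    linarith

lemma unstable_unique (e : ℝ) (he : 0 < e) (s t : ℂ) (hs : IsUnstableEigenvalue e s)
    (ht : IsUnstableEigenvalue e t) : s = t := by
  obtain ⟨h1, u, v, hne, h2, h3⟩ := hs
  obtain ⟨k1, p, q, kne, k2, k3⟩ := ht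
  have mk : ∀ (s : ℂ) (u v : SchwartzMap ℝ ℂ),
      (∀ x : ℝ, (-iteratedDeriv 2 (⇑u) x + u x - 3 * (Q x : ℂ) ^ 2 * u x)
        + (e : ℂ) ^ 2 * u x = -s * v x) →
      (∀ x : ℝ, (-iteratedDeriv 2 (⇑v) x + v x - (Q x : ℂ) ^ 2 * v x)
        + (e : ℂ) ^ 2 * v x = s * u x) → Sys e s u v := by
    intro s u v a b
    constructor
    · intro x
      rw [← a x, iter_dS, Q_sq]; push_cast; ring
    · intro x
      rw [← b x, iter_dS, Q_sq]; push_cast; ring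
  exact (mk s u v h2 h3).unique he h1 k1 (mk t p q k2 k3) hne kne

end Helpers

/-- For every `ε > 0` there is at most one unstable eigenvalue, and for all
sufficiently small `ε > 0` there is exactly one. -/
theorem nls_unstable_eigenvalue_unique_and_exists :
    (∀ ε : ℝ, 0 < ε → ∀ σ₁ σ₂ : ℂ,
      IsUnstableEigenvalue ε σ₁ → IsUnstableEigenvalue ε σ₂ → σ₁ = σ₂) ∧
    ∃ ε₀ : ℝ, 0 < ε₀ ∧ ∀ ε : ℝ, 0 < ε → ε ≤ ε₀ →
      ∃! σ : ℂ, IsUnstableEigenvalue ε σ := by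
  refine ⟨unstable_unique, ?_⟩
  obtain ⟨e0, he0, H⟩ := exists_unstable
  refine ⟨e0, he0, fun e he hle => ?_⟩
  obtain ⟨s, hs⟩ := H e he hle
  exact ⟨s, hs, fun t ht => unstable_unique e he t s ht hs⟩
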